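/- Fix β ∈ (−1,1). There exist x₀ > 0, Δ₀ > 0 and C > 0 such that for all α = 2−Δ with 0 < Δ < Δ₀ and all real x with |x| ≥ x₀, writing y = x−ζ: | f_β(x;α,β) − Δ·sgn(y)/|y|^{1+α} | ≤ C·Δ·|y|^{−1−α}·( Δ + 1/|y| + 1/|y|^α ), where f_β(x;α,β) denotes the partial derivative of the density f(x;α,β) with respect to β. Moreover there exist C′ > 0 and Δ₁ > 0 such that |f_β(x;α,β)| ≤ C′·Δ for all 0 < Δ < Δ₁ and all x ∈ ℝ. -/

import Mathlib

open MeasureTheory Filter Set Topology Real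

/-- Shift parameter ζ = −β·tan(πα/2) in Zolotarev's (M) parameterization. -/
noncomputable def zetaPar (α β : ℝ) : ℝ := -β * Real.tan (Real.pi * α / 2)

/-- Standard stable density in Zolotarev's (M) parameterization, via the inversion formula. -/
noncomputable def stableDensity (α β x : ℝ) : ℝ :=
  (1 / Real.pi) *
    (∫ t in Set.Ioi (0 : ℝ),
      Complex.exp (-(Complex.I * (t : ℂ) * (x : ℂ))) *
        Complex.exp (-(((t ^ α : ℝ) : ℂ)) *
          (1 + Complex.I * (β : ℂ) * ((Real.tan (Real.pi * α / 2) : ℝ) : ℂ) *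
            (((t ^ (1 - α) : ℝ) : ℂ) - 1)))).re

/-- The N(0,2) density f(y;2). -/
noncomputable def normalDensity (y : ℝ) : ℝ :=
  (1 / (2 * Real.sqrt Real.pi)) * Real.exp (-(y ^ 2) / 4)

/-- Partial derivative of the stable density with respect to α. -/
noncomputable def fAlpha (α β x : ℝ) : ℝ := deriv (fun a : ℝ => stableDensity a β x) α

/-- Partial derivative of the stable density with respect to β. -/
noncomputable def fBeta (α β x : ℝ) : ℝ := deriv (fun b : ℝ => stableDensity α b x) β

/-- Derivative of the stable density in x. -/
noncomputable def fX (α β x : ℝ) : ℝ := deriv (stableDensity α β) x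

/-- The scale score numerator f_σ = −f − x·f′. -/
noncomputable def fSig (α β x : ℝ) : ℝ := -stableDensity α β x - x * fX α β x


lemma shiftG (G : ℂ → ℂ) (hG : Differentiable ℂ G) (a b : ℝ) (hab : a ≤ b) (B : ℝ → ℝ)
    (hBi : Integrable B) (h1 : Tendsto B atTop (𝓝 0)) (h2 : Tendsto B atBot (𝓝 0))
    (hbd : ∀ u v : ℝ, a ≤ v → v ≤ b → ‖G (u + v * Complex.I)‖ ≤ B u) :
    ∫ u : ℝ, G (u + a * Complex.I) = ∫ u : ℝ, G (u + b * Complex.I) := by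
  have hint : ∀ v : ℝ, a ≤ v → v ≤ b → Integrable (fun u : ℝ => G (u + v * Complex.I)) := by
    intro v hv hv'
    refine hBi.mono' ?_ (Eventually.of_forall fun u => hbd u v hv hv')
    exact (hG.continuous.comp (by fun_prop)).aestronglyMeasurable
  have key : ∀ R : ℝ, (∫ u in (-R)..R, G (u + a * Complex.I)) - (∫ u in (-R)..R, G (u + b * Complex.I))
      = Complex.I • (∫ v in a..b, G ((-R : ℝ) + v * Complex.I)) - Complex.I • (∫ v in a..b, G (R + v * Complex.I)) := by
    intro R
    have := Complex.integral_boundary_rect_eq_zero_of_differentiableOn G ⟨-R, a⟩ ⟨R, b⟩ hG.differentiableOn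
    simp only at this
    linear_combination this
  have e1 := intervalIntegral_tendsto_integral (hint a le_rfl hab) tendsto_neg_atTop_atBot tendsto_id
  have e2 := intervalIntegral_tendsto_integral (hint b hab le_rfl) tendsto_neg_atTop_atBot tendsto_id
  have v1 : Tendsto (fun R : ℝ => ∫ v in a..b, G (R + v * Complex.I)) atTop (𝓝 0) := by
    refine squeeze_zero_norm (a := fun R => B R * |b - a|) (fun R => ?_) (by simpa using h1.mul_const _)
    refine intervalIntegral.norm_integral_le_of_norm_le_const fun v hv => ?_
    rw [uIoc_of_le hab] at hv
    exact hbd _ _ hv.1.le hv.2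
  have v2 : Tendsto (fun R : ℝ => ∫ v in a..b, G ((-R : ℝ) + v * Complex.I)) atTop (𝓝 0) := by
    refine squeeze_zero_norm (a := fun R => B (-R) * |b - a|) (fun R => ?_)
      (by simpa using (h2.comp tendsto_neg_atTop_atBot).mul_const _)
    refine intervalIntegral.norm_integral_le_of_norm_le_const fun v hv => ?_
    rw [uIoc_of_le hab] at hv
    exact hbd _ _ hv.1.le hv.2
  have e3 := e1.sub e2
  have e4 := (v2.const_smul Complex.I).sub (v1.const_smul Complex.I)
  simp only [smul_zero, sub_zero] at e4
  have := tendsto_nhds_unique (e3.congr (fun R => key R)) e4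
  exact sub_eq_zero.mp this

lemma subst_exp (h : ℝ → ℂ) : ∫ t in Ioi (0:ℝ), h t = ∫ u : ℝ, (Real.exp u : ℂ) * h (Real.exp u) := by
  have := integral_image_eq_integral_abs_deriv_smul (s := univ) (f := Real.exp) (f' := Real.exp)
    MeasurableSet.univ (fun x _ => (Real.hasDerivAt_exp x).hasDerivWithinAt) Real.exp_injective.injOn h
  rw [image_univ, Real.range_exp] at this
  rw [this]
  simp [abs_of_pos (Real.exp_pos _)]

lemma int_exp (h : ℝ → ℝ) (hh : IntegrableOn h (Ioi 0)) : Integrable (fun u : ℝ => Real.exp u * h (Real.exp u)) := by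
  have := integrableOn_image_iff_integrableOn_abs_deriv_smul (s := univ) (f := Real.exp) (f' := Real.exp)
    MeasurableSet.univ (fun x _ => (Real.hasDerivAt_exp x).hasDerivWithinAt) Real.exp_injective.injOn h
  rw [image_univ, Real.range_exp] at this
  simpa [abs_of_pos (Real.exp_pos _)] using this.1 hh

lemma B_int {a k p : ℝ} (ha : 0 < a) (hk : 0 < k) (hp : 0 < p) :
    Integrable (fun u : ℝ => Real.exp (a * u - k * Real.exp (p * u))) := by
  have h := int_exp _ (integrableOn_rpow_mul_exp_neg_mul_rpow (s := a - 1) (by linarith) hp hk)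
  refine h.congr (Eventually.of_forall fun u => ?_)
  simp only
  rw [← Real.exp_mul, ← Real.exp_mul, ← Real.exp_add, ← Real.exp_add]
  congr 1
  rw [mul_comm u p]; ring

lemma B_top {a k p : ℝ} (hk : 0 < k) (hp : 0 < p) :
    Tendsto (fun u : ℝ => Real.exp (a * u - k * Real.exp (p * u))) atTop (𝓝 0) := by
  have h1 := tendsto_rpow_mul_exp_neg_mul_atTop_nhds_zero (a / p) k hk
  have h2 : Tendsto (fun u : ℝ => Real.exp (p * u)) atTop atTop :=
    Real.tendsto_exp_atTop.comp (tendsto_id.const_mul_atTop hp)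
  refine (h1.comp h2).congr fun u => ?_
  simp only [Function.comp]
  rw [← Real.exp_mul, ← Real.exp_add]
  congr 1
  field_simp
  ring

lemma B_bot {a k p : ℝ} (ha : 0 < a) (hk : 0 < k) :
    Tendsto (fun u : ℝ => Real.exp (a * u - k * Real.exp (p * u))) atBot (𝓝 0) := by
  refine squeeze_zero (g := fun u => Real.exp (a * u)) (fun u => (Real.exp_pos _).le) (fun u => ?_)
    (Real.tendsto_exp_atBot.comp (tendsto_id.const_mul_atBot ha))
  apply Real.exp_le_exp.2
  have := mul_pos hk (Real.exp_pos (p * u))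
  linarith

lemma gam_int {a k : ℝ} (ha : 0 < a) (hk : 0 < k) :
    ∫ u : ℝ, Real.exp (a * u - k * Real.exp u) = (1 / k) ^ a * Real.Gamma a := by
  rw [← Real.integral_rpow_mul_exp_neg_mul_Ioi ha hk]
  have := integral_image_eq_integral_abs_deriv_smul (s := univ) (f := Real.exp) (f' := Real.exp)
    MeasurableSet.univ (fun x _ => (Real.hasDerivAt_exp x).hasDerivWithinAt) Real.exp_injective.injOn
    (fun t : ℝ => t ^ (a - 1) * Real.exp (-(k * t)))
  rw [image_univ, Real.range_exp] at this
  rw [this, setIntegral_univ]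
  congr 1
  ext u
  rw [abs_of_pos (Real.exp_pos _), smul_eq_mul, ← Real.exp_mul, ← Real.exp_add, ← Real.exp_add]
  congr 1
  ring

/-- integrand in log coordinates -/
noncomputable def GG (α a y : ℝ) (c w : ℂ) : ℂ :=
  Complex.exp (a * w - Complex.I * y * Complex.exp w - c * Complex.exp (α * w))

lemma GG_diff (α a y : ℝ) (c : ℂ) : Differentiable ℂ (GG α a y c) := by
  unfold GG; fun_prop

lemma GG_norm (α a y : ℝ) (c : ℂ) (u v : ℝ) : ‖GG α a y c (u + v * Complex.I)‖ =
    Real.exp (a * u + y * Real.sin v * Real.exp u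
      - (c.re * Real.cos (α * v) - c.im * Real.sin (α * v)) * Real.exp (α * u)) := by
  unfold GG
  rw [Complex.norm_exp]
  congr 1
  simp [Complex.exp_re, Complex.exp_im]
  ring

lemma norm_exp_sub_one_le' (z : ℂ) (hz : z.re ≤ 0) : ‖Complex.exp z - 1‖ ≤ ‖z‖ := by
  have := (convex_halfSpace_re_le 0).norm_image_sub_le_of_norm_hasDerivWithin_le (𝕜 := ℂ)
    (f := Complex.exp) (f' := Complex.exp) (C := 1) (x := 0) (y := z)
    (fun x _ => (Complex.hasDerivAt_exp x).hasDerivWithinAt)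
    (fun x hx => by rw [Complex.norm_exp]; simpa using hx) (by simp) (by simpa using hz)
  simpa using this

lemma trig_low {α v ζ : ℝ} (h1 : 0 < α) (h2 : α ≤ 2) (hv : -(π / 6) ≤ v) (hv' : v ≤ 0) (hζ : |ζ| ≤ 1 / 4) :
    1 / 4 ≤ Real.cos (α * v) - ζ * Real.sin (α * v) := by
  have hc : 1 / 2 ≤ Real.cos (α * v) := by
    rw [← Real.cos_pi_div_three, ← Real.cos_abs (α * v)]
    apply Real.cos_le_cos_of_nonneg_of_le_pi (abs_nonneg _) (by linarith [Real.pi_pos])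
    rw [abs_of_nonpos (by nlinarith)]
    nlinarith
  have : |ζ * Real.sin (α * v)| ≤ 1 / 4 := by
    rw [abs_mul]
    nlinarith [Real.abs_sin_le_one (α * v), abs_nonneg ζ, abs_nonneg (Real.sin (α * v))]
  linarith [abs_le.1 this]

lemma core {α a y ζ : ℝ} (h1 : 1 ≤ α) (h2 : α ≤ 2) (ha : 0 < a) (hy : 0 < y) (hζ : |ζ| ≤ 1 / 4) :
    ‖(∫ u : ℝ, GG α a y (1 + ζ * Complex.I) u)
      - Complex.exp (-(a * (π / 2) : ℝ) * Complex.I) * ((y ^ (-a) * Real.Gamma a : ℝ) : ℂ)‖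
      ≤ 2 * ((2 / y) ^ (a + α) * Real.Gamma (a + α)) := by
  have hα : 0 < α := by linarith
  set c : ℂ := 1 + ζ * Complex.I with hc
  have hcre : c.re = 1 := by simp [hc]
  have hcim : c.im = ζ := by simp [hc]
  have hpi := Real.pi_pos
  -- first shift
  have s1 := shiftG (GG α a y c) (GG_diff _ _ _ _) (-(π / 6)) 0 (by linarith)
    (fun u : ℝ => Real.exp (a * u - (1 / 4) * Real.exp (α * u)))
    (B_int ha (by norm_num) hα) (B_top (by norm_num) hα) (B_bot ha (by norm_num)) (by
      intro u v hv hv'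
      rw [GG_norm, hcre, hcim]
      apply Real.exp_le_exp.2
      have t := trig_low hα h2 hv hv' hζ
      have s : Real.sin v ≤ 0 := Real.sin_nonpos_of_nonpos_of_neg_pi_le hv' (by linarith)
      have e1 := Real.exp_pos u
      have e2 := Real.exp_pos (α * u)
      have : y * Real.sin v * Real.exp u ≤ 0 :=
        mul_nonpos_of_nonpos_of_nonneg (mul_nonpos_of_nonneg_of_nonpos hy.le s) e1.le
      nlinarith)
  have hsin : ∀ v : ℝ, -(π / 2) ≤ v → v ≤ -(π / 6) → Real.sin v ≤ - (1 / 2) := by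
    intro v hv hv'
    have : Real.sin v ≤ Real.sin (-(π / 6)) :=
      Real.sin_le_sin_of_le_of_le_pi_div_two (by linarith) (by linarith) hv'
    rw [Real.sin_neg, Real.sin_pi_div_six] at this
    exact this
  have kb : ∀ u v : ℝ, -(π / 2) ≤ v → v ≤ -(π / 6) →
      ‖GG α a y 0 (u + v * Complex.I)‖ ≤ Real.exp (a * u - (y / 2) * Real.exp (1 * u)) := by
    intro u v hv hv'
    rw [GG_norm]
    apply Real.exp_le_exp.2
    have e1 := Real.exp_pos u
    have t := hsin v hv hv'
    have : y * Real.sin v * Real.exp u ≤ y * (-(1/2)) * Real.exp u := by gcongr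
    simp
    linarith
  have s2 := shiftG (GG α a y 0) (GG_diff _ _ _ _) (-(π / 2)) (-(π / 6)) (by linarith)
    (fun u : ℝ => Real.exp (a * u - (y / 2) * Real.exp (1 * u)))
    (B_int ha (by positivity) one_pos) (B_top (by positivity) one_pos) (B_bot ha (by positivity)) kb
  have m : ∫ u : ℝ, GG α a y 0 (u + (-(π / 2) : ℝ) * Complex.I) =
      Complex.exp (-(a * (π / 2) : ℝ) * Complex.I) * ((y ^ (-a) * Real.Gamma a : ℝ) : ℂ) := by
    have : (y ^ (-a) * Real.Gamma a : ℝ) = ∫ u : ℝ, Real.exp (a * u - y * Real.exp u) := by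
      rw [gam_int ha hy, one_div, Real.inv_rpow hy.le, Real.rpow_neg hy.le]
    rw [this, ← integral_complex_ofReal, ← integral_const_mul]
    congr 1
    ext u
    unfold GG
    have e : Complex.exp (u + (-(π / 2) : ℝ) * Complex.I) = -Complex.I * Complex.exp u := by
      rw [Complex.exp_add]
      have : ((-(π / 2) : ℝ) : ℂ) * Complex.I = -(π / 2 * Complex.I) := by push_cast; ring
      rw [this, Complex.exp_neg, Complex.exp_pi_div_two_mul_I, Complex.inv_I]
      ring
    rw [e]
    push_cast
    rw [← Complex.exp_add]
    congr 1
    linear_combination (y : ℂ) * Complex.exp u * Complex.I_sq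
  have z0 : ∀ u : ℝ, GG α a y c (u + (0 : ℝ) * Complex.I) = GG α a y c u := by intro u; simp
  simp only [z0] at s1
  rw [← s1, ← m, s2, ← integral_sub]
  · have hb : ∀ u : ℝ, ‖GG α a y c (u + (-(π / 6) : ℝ) * Complex.I) - GG α a y 0 (u + (-(π / 6) : ℝ) * Complex.I)‖
        ≤ 2 * Real.exp ((a + α) * u - (y / 2) * Real.exp u) := by
      intro u
      set w : ℂ := u + (-(π / 6) : ℝ) * Complex.I with hw
      have : GG α a y c w - GG α a y 0 w = GG α a y 0 w * (Complex.exp (-c * Complex.exp (α * w)) - 1) := by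
        unfold GG
        rw [mul_sub, ← Complex.exp_add]
        congr 2 <;> ring_nf
      rw [this, norm_mul]
      have n1 := kb u (-(π / 6)) (by linarith) le_rfl
      rw [← hw] at n1
      have n2 : ‖Complex.exp (-c * Complex.exp (α * w)) - 1‖ ≤ 2 * Real.exp (α * u) := by
        refine (norm_exp_sub_one_le' _ ?_).trans ?_
        · have t := trig_low hα h2 (le_refl (-(π / 6))) (by linarith) hζ
          have : (-c * Complex.exp (α * w)).re = -(Real.cos (α * (-(π / 6))) - ζ * Real.sin (α * (-(π / 6)))) * Real.exp (α * u) := by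
            simp [Complex.exp_re, Complex.exp_im, hw, hcre, hcim]
            ring
          rw [this]
          have e2 := Real.exp_pos (α * u)
          nlinarith
        · rw [norm_mul, norm_neg, Complex.norm_exp]
          have : (α * w : ℂ).re = α * u := by simp [hw]
          rw [this]
          have : ‖c‖ ≤ 2 := by
            refine (norm_add_le _ _).trans ?_
            simp
            linarith
          gcongr
      calc _ ≤ Real.exp (a * u - (y / 2) * Real.exp (1 * u)) * (2 * Real.exp (α * u)) := by gcongr
        _ = _ := by
          rw [mul_left_comm, ← Real.exp_add]
          congr 2
          rw [one_mul]; ring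
    have bi : Integrable (fun u : ℝ => 2 * Real.exp ((a + α) * u - (y / 2) * Real.exp u)) := by
      have := (B_int (a := a + α) (k := y / 2) (p := 1) (by linarith) (by positivity) one_pos).const_mul 2
      simpa using this
    refine (norm_integral_le_of_norm_le bi (Eventually.of_forall hb)).trans ?_
    rw [integral_const_mul, gam_int (by linarith) (by positivity), one_div, inv_div]
  · refine (B_int (k := 1/4) ha (by norm_num) hα).mono' ?_ (Eventually.of_forall fun u => ?_)
    · exact ((GG_diff _ _ _ _).continuous.comp (by fun_prop)).aestronglyMeasurable
    · rw [GG_norm, hcre, hcim]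
      apply Real.exp_le_exp.2
      have t := trig_low hα h2 (le_refl (-(π / 6))) (by linarith) hζ
      have s := hsin (-(π/6)) (by linarith) le_rfl
      have e1 := Real.exp_pos u
      have e2 := Real.exp_pos (α * u)
      have : y * Real.sin (-(π/6)) * Real.exp u ≤ 0 :=
        mul_nonpos_of_nonpos_of_nonneg (mul_nonpos_of_nonneg_of_nonpos hy.le (by linarith)) e1.le
      nlinarith
  · refine (B_int (k := y / 2) ha (by positivity) one_pos).mono' ?_ (Eventually.of_forall fun u => kb u _ (by linarith) le_rfl)
    exact ((GG_diff _ _ _ _).continuous.comp (by fun_prop)).aestronglyMeasurable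

lemma GG_norm0 (α a y ζ u : ℝ) : ‖GG α a y (1 + ζ * Complex.I) u‖ = Real.exp (a * u - Real.exp (α * u)) := by
  have := GG_norm α a y (1 + ζ * Complex.I) u 0
  simpa using this

lemma GG_int0 (α a y ζ : ℝ) (ha : 0 < a) (hα : 0 < α) :
    Integrable (fun u : ℝ => GG α a y (1 + ζ * Complex.I) u) := by
  refine (B_int (k := 1) ha one_pos hα).mono' ?_ (Eventually.of_forall fun u => ?_)
  · exact ((GG_diff _ _ _ _).continuous.comp (by fun_prop)).aestronglyMeasurable
  · rw [GG_norm0, one_mul]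

lemma GG_bd {α a y ζ : ℝ} (ha : 2 ≤ a) (ha' : a ≤ 3) (hα : 1 ≤ α) :
    ‖∫ u : ℝ, GG α a y (1 + ζ * Complex.I) u‖ ≤ 5 := by
  have i1 := B_int (a := 3) (k := 1) (p := 1) (by norm_num) one_pos one_pos
  have i2 := (B_int (a := 2) (k := 1) (p := 1) (by norm_num) one_pos one_pos).const_mul (Real.exp 1)
  simp only [one_mul] at i1 i2
  refine (norm_integral_le_of_norm_le (i1.add i2) (Eventually.of_forall fun u => ?_)).trans ?_
  · rw [GG_norm0]
    simp only [Pi.add_apply]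
    rcases le_total 0 u with h | h
    · have : Real.exp (a * u - Real.exp (α * u)) ≤ Real.exp (3 * u - Real.exp u) := by
        apply Real.exp_le_exp.2
        have : Real.exp u ≤ Real.exp (α * u) := Real.exp_le_exp.2 (by nlinarith)
        nlinarith
      have := mul_pos (Real.exp_pos 1) (Real.exp_pos (2 * u - Real.exp u))
      linarith
    · have : Real.exp (a * u - Real.exp (α * u)) ≤ Real.exp 1 * Real.exp (2 * u - Real.exp u) := by
        rw [← Real.exp_add]
        apply Real.exp_le_exp.2
        have : Real.exp u ≤ 1 := Real.exp_le_one_iff.2 h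
        nlinarith [Real.exp_pos (α * u)]
      have := (Real.exp_pos (3 * u - Real.exp u))
      linarith
  · rw [integral_add' i1 i2, integral_const_mul]
    have g1 := gam_int (a := 3) (k := 1) (by norm_num) one_pos
    have g2 := gam_int (a := 2) (k := 1) (by norm_num) one_pos
    simp only [one_mul] at g1 g2
    have q1 : Real.Gamma 3 = 2 := by
      have := Real.Gamma_nat_eq_factorial 2
      norm_num at this; simp
    rw [g1, g2, q1, Real.Gamma_two]
    have := Real.exp_one_lt_d9
    norm_num
    linarith

lemma fBeta_eq {α : ℝ} (h1 : 1 ≤ α) (β x : ℝ) :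
    fBeta α β x = (-Real.tan (π * α / 2)) / π *
      ((∫ u : ℝ, GG α (α + 1) (x - zetaPar α β) (1 + (zetaPar α β : ℝ) * Complex.I) u).im
        - (∫ u : ℝ, GG α 2 (x - zetaPar α β) (1 + (zetaPar α β : ℝ) * Complex.I) u).im) := by
  have hα : 0 < α := by linarith
  set T := Real.tan (π * α / 2) with hT
  have hz : zetaPar α β = -β * T := rfl
  set F : ℝ → ℝ → ℂ := fun b t => Complex.exp (-(Complex.I * (t : ℂ) * (x : ℂ))) *
        Complex.exp (-(((t ^ α : ℝ) : ℂ)) *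
          (1 + Complex.I * (b : ℂ) * (T : ℂ) * (((t ^ (1 - α) : ℝ) : ℂ) - 1))) with hF
  set F' : ℝ → ℝ → ℂ := fun b t => F b t * (-(((t ^ α : ℝ) : ℂ)) *
          (Complex.I * (T : ℂ) * (((t ^ (1 - α) : ℝ) : ℂ) - 1))) with hF'
  have mt : ∀ s : ℝ, Measurable (fun t : ℝ => ((t ^ s : ℝ) : ℂ)) := fun s => by fun_prop
  have mF : ∀ b, Measurable (F b) := fun b => by
    have := mt α
    have := mt (1 - α)
    simp only [hF]
    fun_prop
  have mF' : ∀ b, Measurable (F' b) := fun b => by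
    have := mt α
    have := mt (1 - α)
    have := mF b
    simp only [hF']
    fun_prop
  have nF : ∀ b t, ‖F b t‖ = Real.exp (-t ^ α) := by
    intro b t
    simp only [hF]
    rw [norm_mul, Complex.norm_exp, Complex.norm_exp, ← Real.exp_add]
    congr 1
    simp
  have ig : ∀ s : ℝ, -1 < s → IntegrableOn (fun t : ℝ => t ^ s * Real.exp (-t ^ α)) (Ioi 0) := by
    intro s hs
    have := integrableOn_rpow_mul_exp_neg_mul_rpow (b := 1) hs hα one_pos
    simpa using this
  have key := hasDerivAt_integral_of_dominated_loc_of_deriv_le (μ := volume.restrict (Ioi (0:ℝ)))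
    (F := F) (F' := F') (x₀ := β) (s := univ)
    (bound := fun t => |T| * (t ^ (1:ℝ) * Real.exp (-t ^ α) + t ^ α * Real.exp (-t ^ α)))
    univ_mem (Eventually.of_forall fun b => (mF b).aestronglyMeasurable)
    (by
      refine (ig 0 (by norm_num)).mono' (mF β).aestronglyMeasurable (Eventually.of_forall fun t => ?_)
      rw [nF]; simp)
    (mF' β).aestronglyMeasurable
    (by
      refine (ae_restrict_mem measurableSet_Ioi).mono fun t (ht : 0 < t) b _ => ?_
      simp only [hF']
      rw [norm_mul, nF]
      have e : (-(((t ^ α : ℝ) : ℂ)) * (Complex.I * (T : ℂ) * (((t ^ (1 - α) : ℝ) : ℂ) - 1)))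
          = Complex.I * ((T * (t ^ α - t ^ (1:ℝ)) : ℝ) : ℂ) := by
        have : t ^ (1:ℝ) = t ^ α * t ^ (1 - α) := by rw [← Real.rpow_add ht]; congr 1; ring
        rw [this]; push_cast; ring
      rw [e, norm_mul, Complex.norm_I, one_mul, Complex.norm_real, norm_mul, Real.norm_eq_abs, Real.norm_eq_abs]
      have p1 := Real.rpow_pos_of_pos ht α
      have p2 := Real.rpow_pos_of_pos ht (1:ℝ)
      have : |t ^ α - t ^ (1:ℝ)| ≤ t ^ (1:ℝ) + t ^ α := by
        have aux : ∀ p q : ℝ, 0 < p → 0 < q → |p - q| ≤ q + p := fun p q hp hq => by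
          rw [abs_le]; constructor <;> linarith
        exact aux _ _ p1 p2
      calc _ ≤ Real.exp (-t ^ α) * (|T| * (t ^ (1:ℝ) + t ^ α)) := by gcongr
        _ = _ := by ring)
    (((ig 1 (by norm_num)).add (ig α (by linarith))).const_mul _)
    (Eventually.of_forall fun t b _ => by
      simp only [hF', hF]
      have h0 : HasDerivAt (fun b : ℝ => -(((t ^ α : ℝ) : ℂ)) *
          (1 + Complex.I * (b : ℂ) * (T : ℂ) * (((t ^ (1 - α) : ℝ) : ℂ) - 1)))
          (-(((t ^ α : ℝ) : ℂ)) * (Complex.I * (T : ℂ) * (((t ^ (1 - α) : ℝ) : ℂ) - 1))) b := by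
        have hb : HasDerivAt (fun b : ℝ => (b : ℂ)) 1 b := Complex.ofRealCLM.hasDerivAt
        have := ((((hb.const_mul Complex.I).mul_const (T : ℂ)).mul_const
          (((t ^ (1 - α) : ℝ) : ℂ) - 1)).const_add 1).const_mul (-(((t ^ α : ℝ) : ℂ)))
        simpa using this
      have := (h0.cexp).const_mul (Complex.exp (-(Complex.I * (t : ℂ) * (x : ℂ))))
      simpa only [mul_assoc] using this)
  have d1 : HasDerivAt (fun b : ℝ => (1 / π) * (∫ t in Ioi (0:ℝ), F b t).re)
      ((1 / π) * (∫ t in Ioi (0:ℝ), F' β t).re) β :=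
    (Complex.reCLM.hasFDerivAt.comp_hasDerivAt β key.2).const_mul _
  have d2 : fBeta α β x = (1 / π) * (∫ t in Ioi (0:ℝ), F' β t).re := d1.deriv
  have s : ∫ t in Ioi (0:ℝ), F' β t = Complex.I * T * ((∫ u : ℝ, GG α (α + 1) (x - zetaPar α β) (1 + (zetaPar α β : ℝ) * Complex.I) u)
        - (∫ u : ℝ, GG α 2 (x - zetaPar α β) (1 + (zetaPar α β : ℝ) * Complex.I) u)) := by
    rw [subst_exp, ← integral_sub (GG_int0 _ _ _ _ (by linarith) hα) (GG_int0 _ _ _ _ (by norm_num) hα),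
      ← integral_const_mul]
    congr 1
    ext u
    have r : ∀ s : ℝ, Real.exp u ^ s = Real.exp (s * u) := fun s => by rw [← Real.exp_mul, mul_comm]
    simp only [hF', hF, r]
    have ee : Complex.exp u = Complex.exp (α * u) * Complex.exp ((1 - α) * u) := by
      rw [← Complex.exp_add]; congr 1; ring
    have E1 : ∀ a : ℝ, GG α a (x - zetaPar α β) (1 + (zetaPar α β : ℝ) * Complex.I) u =
        Complex.exp (a * u) * (Complex.exp (-(Complex.I * (Complex.exp u) * (x : ℂ))) *
        Complex.exp (-((Complex.exp (α * u))) *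
          (1 + Complex.I * (β : ℂ) * (T : ℂ) * (Complex.exp ((1 - α) * u) - 1)))) := by
      intro a
      unfold GG
      rw [← Complex.exp_add, ← Complex.exp_add, hz]
      congr 1
      push_cast
      linear_combination (Complex.I * (-β) * T) * ee
    rw [E1, E1]
    have e3 : Complex.exp ((α + 1 : ℝ) * u) = Complex.exp u * Complex.exp (α * u) := by
      rw [← Complex.exp_add]; congr 1; push_cast; ring
    have e4 : Complex.exp ((2 : ℝ) * u) = Complex.exp u * (Complex.exp (α * u) * Complex.exp ((1 - α) * u)) := by
      rw [← ee, ← Complex.exp_add]; congr 1; push_cast; ring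
    rw [e3, e4]
    push_cast
    ring
  rw [d2, s]
  simp
  ring

lemma GG_conj (α a y ζ u : ℝ) : GG α a (-y) (1 + ((-ζ : ℝ) : ℂ) * Complex.I) u =
    (starRingEnd ℂ) (GG α a y (1 + ζ * Complex.I) u) := by
  unfold GG
  rw [← Complex.exp_conj]
  congr 1
  simp [← Complex.exp_conj]

lemma Gamma_three' : Real.Gamma 3 = 2 := by
  norm_num [Nat.factorial]

lemma imJ_pos {α a y ζ : ℝ} (h1 : 1 ≤ α) (h2 : α ≤ 2) (ha : 2 ≤ a) (ha' : a ≤ 3) (hy : 0 < y)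
    (hζ : |ζ| ≤ 1 / 4) :
    |(∫ u : ℝ, GG α a y (1 + ζ * Complex.I) u).im - (-Real.sin (a * (π / 2))) * (y ^ (-a) * Real.Gamma a)|
      ≤ 1536 * y ^ (-(a + α)) := by
  have h := (Complex.abs_im_le_norm _).trans (core h1 h2 (by linarith : 0 < a) hy hζ)
  have e : (Complex.exp (-(a * (π / 2) : ℝ) * Complex.I) * ((y ^ (-a) * Real.Gamma a : ℝ) : ℂ)).im
      = (-Real.sin (a * (π / 2))) * (y ^ (-a) * Real.Gamma a) := by
    rw [Complex.im_mul_ofReal, ← Complex.ofReal_neg, Complex.exp_ofReal_mul_I_im, Real.sin_neg]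
  rw [Complex.sub_im, e] at h
  refine h.trans ?_
  have g : Real.Gamma (a + α) ≤ 24 := by
    have g5 : Real.Gamma 5 = 24 := by
      norm_num [Nat.factorial]
    rw [← g5]
    exact Real.Gamma_strictMonoOn_Ici.monotoneOn (by simp; linarith) (by simp; norm_num) (by linarith)
  have p : (2:ℝ) ^ (a + α) ≤ 32 := by
    calc (2:ℝ) ^ (a + α) ≤ 2 ^ (5:ℝ) := Real.rpow_le_rpow_of_exponent_le (by norm_num) (by linarith)
      _ = 32 := by norm_num
  rw [Real.div_rpow (by norm_num) hy.le, Real.rpow_neg hy.le, div_eq_mul_inv]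
  have q : 0 < (y ^ (a + α))⁻¹ := by positivity
  calc 2 * (2 ^ (a + α) * (y ^ (a + α))⁻¹ * Real.Gamma (a + α))
      ≤ 2 * (32 * (y ^ (a + α))⁻¹ * 24) := by gcongr
    _ = _ := by ring

lemma imJ {α a y ζ : ℝ} (h1 : 1 ≤ α) (h2 : α ≤ 2) (ha : 2 ≤ a) (ha' : a ≤ 3) (hy : y ≠ 0)
    (hζ : |ζ| ≤ 1 / 4) :
    |(∫ u : ℝ, GG α a y (1 + ζ * Complex.I) u).im
        - Real.sign y * ((-Real.sin (a * (π / 2))) * (|y| ^ (-a) * Real.Gamma a))|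
      ≤ 1536 * |y| ^ (-(a + α)) := by
  rcases lt_or_gt_of_ne hy with h | h
  · rw [Real.sign_of_neg h, abs_of_neg h]
    have := imJ_pos (ζ := -ζ) h1 h2 ha ha' (neg_pos.2 h) (by rwa [abs_neg])
    simp only [GG_conj] at this
    rw [integral_conj, Complex.conj_im, ← abs_neg] at this
    convert this using 2
    ring
  · rw [Real.sign_of_pos h, abs_of_pos h, one_mul]
    exact imJ_pos h1 h2 ha ha' h hζ

lemma tan_facts {Δ : ℝ} (h0 : 0 < Δ) (h1 : Δ < 1 / 16) :
    Real.tan (π * (2 - Δ) / 2) = -Real.tan (π * Δ / 2) ∧ 0 ≤ Real.tan (π * Δ / 2) ∧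
    Real.tan (π * Δ / 2) ≤ 4 * Δ ∧ Real.tan (π * Δ / 2) * Real.cos (π * Δ / 2) = Real.sin (π * Δ / 2) := by
  have hp := Real.pi_pos
  have hp4 := Real.pi_le_four
  have p0 : 0 < π * Δ / 2 := by positivity
  have p1 : π * Δ / 2 ≤ 2 * Δ := by nlinarith
  have c : 1 / 2 ≤ Real.cos (π * Δ / 2) := by
    have := Real.one_sub_sq_div_two_le_cos (x := π * Δ / 2)
    nlinarith
  have s := Real.sin_le p0.le
  have s0 : 0 ≤ Real.sin (π * Δ / 2) := Real.sin_nonneg_of_nonneg_of_le_pi p0.le (by nlinarith)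
  refine ⟨?_, ?_, ?_, ?_⟩
  · have : π * (2 - Δ) / 2 = π - π * Δ / 2 := by ring
    rw [this, Real.tan_pi_sub]
  · rw [Real.tan_eq_sin_div_cos]; exact div_nonneg s0 (by linarith)
  · rw [Real.tan_eq_sin_div_cos, div_le_iff₀ (by linarith)]; nlinarith
  · exact Real.tan_mul_cos (by linarith)

lemma coeff {Δ : ℝ} (h0 : 0 < Δ) (h1 : Δ < 1 / 16) :
    |Real.sin (π * Δ / 2) * Real.Gamma (3 - Δ) / π - Δ| ≤ 4 * Δ ^ 2 := by
  have hp := Real.pi_pos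
  have hp3 := Real.pi_gt_three
  have hp4 := Real.pi_le_four
  have p0 : 0 < π * Δ / 2 := by positivity
  have p1 : π * Δ / 2 ≤ 2 * Δ := by nlinarith
  set p := π * Δ / 2 with hpd
  have s1 := Real.sin_le p0.le
  have s2 := Real.sin_gt_sub_cube p0
  have s0 : 0 ≤ Real.sin p := Real.sin_nonneg_of_nonneg_of_le_pi p0.le (by nlinarith)
  have g1 : Real.Gamma (3 - Δ) ≤ 2 := by
    rw [← Gamma_three']
    exact Real.Gamma_strictMonoOn_Ici.monotoneOn (by simp; linarith) (by simp; norm_num) (by linarith)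
  have g2 : 2 - 4 * Δ ≤ Real.Gamma (3 - Δ) := by
    have g4 : Real.Gamma 4 = 6 := by
      norm_num [Nat.factorial]
    have := Real.convexOn_Gamma.slope_mono_adjacent (x := 3 - Δ) (y := 3) (z := 4)
      (by simp; linarith) (by simp) (by linarith) (by norm_num)
    rw [Gamma_three', g4, div_le_iff₀ (by linarith)] at this
    linarith
  have hcube : p ^ 3 ≤ p * Δ / 4 := by
    have : p ^ 2 ≤ Δ / 4 := by nlinarith
    nlinarith
  have hD : Δ = 2 * p / π := by rw [hpd]; field_simp
  have : Real.sin p * Real.Gamma (3 - Δ) / π - Δ = (Real.sin p * Real.Gamma (3 - Δ) - π * Δ) / π := by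
    field_simp
  rw [this, abs_div, abs_of_pos hp, div_le_iff₀ hp]
  have e : π * Δ = 2 * p := by rw [hpd]; ring
  rw [e, abs_le]
  have e2 : 4 * Δ ^ 2 * π = 8 * (p * Δ) := by rw [hpd]; ring
  rw [e2]
  have pd : 0 < p * Δ := by positivity
  constructor
  · have a1 : Real.sin p * (2 - 4 * Δ) ≤ Real.sin p * Real.Gamma (3 - Δ) := by gcongr
    have a2 : Real.sin p * Δ ≤ p * Δ := by gcongr
    nlinarith
  · have a1 : Real.sin p * Real.Gamma (3 - Δ) ≤ Real.sin p * 2 := by gcongr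
    nlinarith

theorem fBeta_asymptotic (β : ℝ) (hβ : β ∈ Set.Ioo (-1 : ℝ) 1) :
    (∃ x₀ > (0 : ℝ), ∃ Δ₀ > (0 : ℝ), ∃ C > (0 : ℝ),
      ∀ Δ : ℝ, 0 < Δ → Δ < Δ₀ → ∀ x : ℝ, x₀ ≤ |x| →
        |fBeta (2 - Δ) β x -
            Δ * Real.sign (x - zetaPar (2 - Δ) β) /
              |x - zetaPar (2 - Δ) β| ^ (1 + (2 - Δ))| ≤
          C * Δ * |x - zetaPar (2 - Δ) β| ^ (-(1 + (2 - Δ))) *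
            (Δ + 1 / |x - zetaPar (2 - Δ) β| +
              1 / |x - zetaPar (2 - Δ) β| ^ (2 - Δ))) ∧
    (∃ C' > (0 : ℝ), ∃ Δ₁ > (0 : ℝ), ∀ Δ : ℝ, 0 < Δ → Δ < Δ₁ → ∀ x : ℝ,
      |fBeta (2 - Δ) β x| ≤ C' * Δ) := by
  have hb1 : |β| ≤ 1 := abs_le.2 ⟨hβ.1.le, hβ.2.le⟩
  have hp := Real.pi_pos
  have hp3 := Real.pi_gt_three
  constructor
  · refine ⟨2, by norm_num, 1 / 16, by norm_num, 10000, by norm_num, ?_⟩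
    intro Δ h0 hΔ x hx
    obtain ⟨t1, t2, t3, t4⟩ := tan_facts h0 hΔ
    have f := fBeta_eq (α := 2 - Δ) (by linarith) β x
    have hz : |zetaPar (2 - Δ) β| ≤ 1 / 4 := by
      unfold zetaPar
      rw [t1, abs_mul, abs_neg, abs_neg, abs_of_nonneg t2]
      nlinarith [abs_nonneg β]
    rw [t1, neg_neg] at f
    set ζ := zetaPar (2 - Δ) β
    set y := x - ζ with hy
    set τ := Real.tan (π * Δ / 2)
    have hY : 0 < |y| := by
      have : |x| ≤ |y| + |ζ| := by
        have := abs_add_le y ζ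
        rwa [hy, sub_add_cancel] at this
      linarith
    have hy0 : y ≠ 0 := abs_pos.1 hY
    have i1 := imJ (α := 2 - Δ) (a := 2 - Δ + 1) (ζ := ζ) (by linarith) (by linarith) (by linarith)
      (by linarith) hy0 hz
    have i2 := imJ (α := 2 - Δ) (a := 2) (ζ := ζ) (by linarith) (by linarith) (by linarith)
      (by linarith) hy0 hz
    have sn1 : Real.sin ((2 - Δ + 1) * (π / 2)) = -Real.cos (π * Δ / 2) := by
      have : (2 - Δ + 1) * (π / 2) = (π / 2 - π * Δ / 2) + π := by ring
      rw [this, Real.sin_add_pi, Real.sin_pi_div_two_sub]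
    have sn2 : Real.sin (2 * (π / 2)) = 0 := by
      rw [mul_div_cancel₀ _ (by norm_num : (2:ℝ) ≠ 0), Real.sin_pi]
    rw [sn1, neg_neg] at i1
    rw [sn2] at i2
    simp only [neg_zero, zero_mul, mul_zero, sub_zero] at i2
    have hco := coeff h0 hΔ
    have ge : (2 - Δ + 1) = 3 - Δ := by ring
    set I1 := (∫ u : ℝ, GG (2 - Δ) (2 - Δ + 1) y (1 + ζ * Complex.I) u).im
    set I2 := (∫ u : ℝ, GG (2 - Δ) 2 y (1 + ζ * Complex.I) u).im
    set P := |y| ^ (-(1 + (2 - Δ))) with hP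
    have P0 : 0 < P := Real.rpow_pos_of_pos hY _
    have P1 : |y| ^ (-(2 - Δ + 1)) = P := by rw [hP]; congr 1; ring
    have P2 : |y| ^ (-(2 - Δ + 1 + (2 - Δ))) = P * (1 / |y| ^ (2 - Δ)) := by
      rw [hP, one_div, ← Real.rpow_neg hY.le, ← Real.rpow_add hY]; congr 1; ring
    have P3 : |y| ^ (-(2 + (2 - Δ))) = P * (1 / |y|) := by
      rw [hP, one_div, ← Real.rpow_neg_one, ← Real.rpow_add hY]; congr 1; ring
    have P4 : Δ * Real.sign y / |y| ^ (1 + (2 - Δ)) = Δ * Real.sign y * P := by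
      rw [hP, Real.rpow_neg hY.le, div_eq_mul_inv]
    rw [P1, P2, ge] at i1
    rw [P3] at i2
    rw [P4, f]
    have A0 : 0 < 1 / |y| ^ (2 - Δ) := by positivity
    have B0 : 0 < 1 / |y| := by positivity
    set A := 1 / |y| ^ (2 - Δ)
    set B := 1 / |y|
    set g := Real.Gamma (3 - Δ)
    set s := Real.sign y with hs
    have hs1 : |s| ≤ 1 := by
      rcases Real.sign_apply_eq y with h | h | h <;> rw [hs, h] <;> norm_num
    have dec : τ / π * (I1 - I2) - Δ * s * P =
        τ / π * (I1 - s * (Real.cos (π * Δ / 2) * (P * g))) - τ / π * I2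
        + s * P * (Real.sin (π * Δ / 2) * g / π - Δ) := by
      rw [← t4]; ring
    have tp0 : 0 ≤ τ / π := by positivity
    have tp : τ / π ≤ 2 * Δ := by
      rw [div_le_iff₀ hp]; nlinarith
    rw [dec]
    have b1 : |τ / π * (I1 - s * (Real.cos (π * Δ / 2) * (P * g)))| ≤ 2 * Δ * (1536 * (P * A)) := by
      rw [abs_mul, abs_of_nonneg tp0]; gcongr
    have b2 : |τ / π * I2| ≤ 2 * Δ * (1536 * (P * B)) := by
      rw [abs_mul, abs_of_nonneg tp0]; gcongr
    have b3 : |s * P * (Real.sin (π * Δ / 2) * g / π - Δ)| ≤ 1 * P * (4 * Δ ^ 2) := by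
      rw [abs_mul, abs_mul, abs_of_pos P0]; gcongr
    refine (abs_add_le _ _).trans ((add_le_add_left (abs_sub _ _) _).trans ?_)
    have n1 : 0 < Δ * P * A := by positivity
    have n2 : 0 < Δ * P * B := by positivity
    have n3 : 0 < Δ * P * Δ := by positivity
    have := add_le_add (add_le_add b1 b2) b3
    refine this.trans ?_
    nlinarith
  · refine ⟨40, by norm_num, 1 / 16, by norm_num, ?_⟩
    intro Δ h0 hΔ x
    obtain ⟨t1, t2, t3, t4⟩ := tan_facts h0 hΔ
    rw [fBeta_eq (α := 2 - Δ) (by linarith) β x, t1, neg_neg, abs_mul, abs_div, abs_of_nonneg t2, abs_of_pos hp]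
    have tp : Real.tan (π * Δ / 2) / π ≤ 2 * Δ := by
      rw [div_le_iff₀ hp]; nlinarith
    have k : ∀ a : ℝ, 2 ≤ a → a ≤ 3 → |(∫ u : ℝ, GG (2 - Δ) a (x - zetaPar (2 - Δ) β) (1 + (zetaPar (2 - Δ) β : ℝ) * Complex.I) u).im| ≤ 5 :=
      fun a h h' => (Complex.abs_im_le_norm _).trans (GG_bd h h' (by linarith))
    have k1 := abs_le.1 (k (2 - Δ + 1) (by linarith) (by linarith))
    have k2 := abs_le.1 (k 2 (by linarith) (by linarith))
    calc _ ≤ 2 * Δ * 10 := by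
          gcongr
          rw [abs_le]
          constructor <;> linarith [k1.1, k1.2, k2.1, k2.2]
      _ ≤ _ := by linarith
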